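/- arXiv:math/0505606 — 2 statements merged into one kernel-verified Lean document; each statement's English description precedes it below -/
import Mathlib

section
/- Let (Y, Σ) be a measurable space, H a probability measure on Y, g : Y → [0, ∞) measurable, z ≥ 0, and θ > 1, and assume ∫ log(1 + z g(y)) H(dy) < ∞. Writing L(u) = ∫ log(1 + u z g(y)) H(dy), one has θ ∫₀¹ e^{−θ L(u)} ( ∫ (1 + u z g(y))^{−1} H(dy) ) (1−u)^{θ−1} du = (θ−1) ∫₀¹ e^{−θ L(u)} (1−u)^{θ−2} du. -/
open MeasureTheory Set

section LogTransform

variable {Y : Type*} [MeasurableSpace Y] {H : Measure Y} {w : Y → ℝ}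

theorem continuousOn_integral_log_one_add_mul (hw : Measurable w) (hw0 : ∀ y, 0 ≤ w y)
    (hint : Integrable (fun y => Real.log (1 + w y)) H) :
    ContinuousOn (fun u : ℝ => ∫ y, Real.log (1 + u * w y) ∂H) (Icc 0 1) := by
  refine continuousOn_of_dominated (bound := fun y => Real.log (1 + w y)) ?_ ?_ hint ?_
  · intro u _
    exact (by fun_prop : Measurable fun y => Real.log (1 + u * w y)).aestronglyMeasurable
  · intro u hu
    filter_upwards with y
    have h1 : 0 ≤ u * w y := mul_nonneg hu.1 (hw0 y)
    have h2 : u * w y ≤ w y := mul_le_of_le_one_left (hw0 y) hu.2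
    rw [Real.norm_of_nonneg (Real.log_nonneg (by linarith))]
    exact Real.log_le_log (by linarith) (by linarith)
  · filter_upwards with y
    refine ContinuousOn.log (by fun_prop) fun u hu => ?_
    have h1 : 0 ≤ u * w y := mul_nonneg hu.1 (hw0 y)
    positivity

theorem continuousOn_integral_inv_one_add_mul [IsFiniteMeasure H] (hw : Measurable w)
    (hw0 : ∀ y, 0 ≤ w y) :
    ContinuousOn (fun u : ℝ => ∫ y, (1 + u * w y)⁻¹ ∂H) (Ici 0) := by
  refine continuousOn_of_dominated (bound := fun _ => 1) ?_ ?_ (integrable_const _) ?_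
  · intro u _
    exact (by fun_prop : Measurable fun y => (1 + u * w y)⁻¹).aestronglyMeasurable
  · intro u hu
    filter_upwards with y
    have h1 : 0 ≤ u * w y := mul_nonneg hu (hw0 y)
    rw [Real.norm_of_nonneg (by positivity)]
    exact inv_le_one_of_one_le₀ (by linarith)
  · filter_upwards with y
    refine ContinuousOn.inv₀ (by fun_prop) fun u hu => ?_
    have h1 : 0 ≤ u * w y := mul_nonneg hu (hw0 y)
    positivity

theorem hasDerivAt_integral_log_one_add_mul [IsProbabilityMeasure H] (hw : Measurable w)
    (hw0 : ∀ y, 0 ≤ w y) (hint : Integrable (fun y => Real.log (1 + w y)) H)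
    {u : ℝ} (hu : u ∈ Ioo (0 : ℝ) 1) :
    HasDerivAt (fun v : ℝ => ∫ y, Real.log (1 + v * w y) ∂H)
      ((1 - ∫ y, (1 + u * w y)⁻¹ ∂H) / u) u := by
  have hu0 : 0 < u := hu.1
  have hpos : ∀ v : ℝ, 0 ≤ v → ∀ y, 0 < 1 + v * w y := fun v hv y => by
    have := mul_nonneg hv (hw0 y)
    positivity
  have hi : Integrable (fun y => Real.log (1 + u * w y)) H := by
    refine hint.mono'
      (by fun_prop : Measurable fun y => Real.log (1 + u * w y)).aestronglyMeasurable ?_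
    filter_upwards with y
    have h1 : 0 ≤ u * w y := mul_nonneg hu0.le (hw0 y)
    have h2 : u * w y ≤ w y := mul_le_of_le_one_left (hw0 y) hu.2.le
    rw [Real.norm_of_nonneg (Real.log_nonneg (by linarith))]
    exact Real.log_le_log (by linarith) (by linarith)
  have hinv : Integrable (fun y => (1 + u * w y)⁻¹) H := by
    refine (integrable_const (1 : ℝ)).mono'
      (by fun_prop : Measurable fun y => (1 + u * w y)⁻¹).aestronglyMeasurable ?_
    filter_upwards with y
    have h1 : 0 ≤ u * w y := mul_nonneg hu0.le (hw0 y)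
    rw [Real.norm_of_nonneg (by positivity)]
    exact inv_le_one_of_one_le₀ (by linarith)
  have key := (hasDerivAt_integral_of_dominated_loc_of_deriv_le (μ := H)
    (F := fun (v : ℝ) y => Real.log (1 + v * w y))
    (F' := fun (v : ℝ) y => w y / (1 + v * w y))
    (bound := fun _ => (u / 2)⁻¹) (s := Ioi (u / 2)) (x₀ := u)
    (Ioi_mem_nhds (by linarith)) ?_ hi ?_ ?_ (integrable_const _) ?_).2
  · refine key.congr_deriv ?_
    have hquot : ∀ y, w y / (1 + u * w y) = (1 - (1 + u * w y)⁻¹) / u := fun y => by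
      have hne := (hpos u hu0.le y).ne'
      rw [eq_div_iff hu0.ne', div_mul_eq_mul_div, div_eq_iff hne, sub_mul, inv_mul_cancel₀ hne]
      ring
    rw [integral_congr_ae (Filter.Eventually.of_forall hquot)]
    rw [integral_div, integral_sub (integrable_const _) hinv]
    simp
  · filter_upwards with v
    exact (by fun_prop : Measurable fun y => Real.log (1 + v * w y)).aestronglyMeasurable
  · exact (by fun_prop : Measurable fun y => w y / (1 + u * w y)).aestronglyMeasurable
  · filter_upwards with y v hv
    have hv' : u / 2 < v := hv
    have hp := hpos v (by linarith) y
    rw [Real.norm_of_nonneg (div_nonneg (hw0 y) hp.le), div_le_iff₀ hp,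
      inv_mul_eq_div, le_div_iff₀ (by positivity)]
    nlinarith [mul_le_mul_of_nonneg_right hv'.le (hw0 y)]
  · filter_upwards with y v hv
    have hv' : u / 2 < v := hv
    have hp := hpos v (by linarith) y
    have h1 : HasDerivAt (fun v : ℝ => 1 + v * w y) (w y) v := by
      simpa using ((hasDerivAt_id v).mul_const (w y)).const_add 1
    exact h1.log hp.ne'

theorem integral_exp_neg_mul_integral_inv_mul_rpow [IsProbabilityMeasure H] (hw : Measurable w)
    (hw0 : ∀ y, 0 ≤ w y) (hint : Integrable (fun y => Real.log (1 + w y)) H)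
    {θ : ℝ} (hθ : 1 < θ) {L : ℝ → ℝ} (hL : ∀ u, L u = ∫ y, Real.log (1 + u * w y) ∂H) :
    θ * ∫ u in (0 : ℝ)..1,
        Real.exp (-(θ * L u)) * (∫ y, (1 + u * w y)⁻¹ ∂H) * (1 - u) ^ (θ - 1) =
      (θ - 1) * ∫ u in (0 : ℝ)..1, Real.exp (-(θ * L u)) * (1 - u) ^ (θ - 2) := by
  obtain rfl : L = fun u => ∫ y, Real.log (1 + u * w y) ∂H := funext hL
  set L : ℝ → ℝ := fun u => ∫ y, Real.log (1 + u * w y) ∂H with hLdef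
  set M : ℝ → ℝ := fun u => ∫ y, (1 + u * w y)⁻¹ ∂H with hMdef
  have hLc : ContinuousOn L (Icc 0 1) := continuousOn_integral_log_one_add_mul hw hw0 hint
  have hMc : ContinuousOn M (Icc 0 1) :=
    (continuousOn_integral_inv_one_add_mul hw hw0).mono Icc_subset_Ici_self
  have hEc : ContinuousOn (fun u => Real.exp (-(θ * L u))) (Icc 0 1) := by fun_prop
  have hPc : Continuous fun u : ℝ => (1 - u) ^ (θ - 1) :=
    (continuous_const.sub continuous_id).rpow_const fun _ => Or.inr (by linarith)
  have hI₁ : IntervalIntegrable (fun u => Real.exp (-(θ * L u)) * M u * (1 - u) ^ (θ - 1))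
      volume 0 1 := by
    refine ContinuousOn.intervalIntegrable ?_
    rw [uIcc_of_le zero_le_one]
    exact (hEc.mul hMc).mul hPc.continuousOn
  have hI₂ : IntervalIntegrable (fun u => Real.exp (-(θ * L u)) * (1 - u) ^ (θ - 2))
      volume 0 1 := by
    refine IntervalIntegrable.continuousOn_mul ?_ (by rwa [uIcc_of_le zero_le_one])
    have h := (intervalIntegral.intervalIntegrable_rpow' (a := 0) (b := 1)
      (by linarith : -1 < θ - 2)).comp_sub_left 1
    simpa using h.symm
  have hderiv : ∀ u ∈ Ioo (0 : ℝ) 1,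
      HasDerivAt (fun u => Real.exp (-(θ * L u)) * (u * (1 - u) ^ (θ - 1)))
        (θ * (Real.exp (-(θ * L u)) * M u * (1 - u) ^ (θ - 1)) -
          (θ - 1) * (Real.exp (-(θ * L u)) * (1 - u) ^ (θ - 2))) u := by
    intro u hu
    have h1u : 0 < 1 - u := by linarith [hu.2]
    have hLd : HasDerivAt L ((1 - M u) / u) u :=
      hasDerivAt_integral_log_one_add_mul hw hw0 hint hu
    have hP : HasDerivAt (fun u : ℝ => (1 - u) ^ (θ - 1))
        (-1 * (θ - 1) * (1 - u) ^ (θ - 1 - 1)) u :=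
      ((hasDerivAt_id u).const_sub 1).rpow_const (Or.inl h1u.ne')
    refine ((hLd.const_mul θ).neg.exp.mul ((hasDerivAt_id u).mul hP)).congr_deriv ?_
    have hpow : (1 - u) ^ (θ - 1) = (1 - u) ^ (θ - 2) * (1 - u) := by
      rw [← Real.rpow_add_one h1u.ne']
      ring_nf
    have hsub : θ - 1 - 1 = θ - 2 := by ring
    have hu0 : u ≠ 0 := hu.1.ne'
    simp only [id, Pi.mul_apply, Pi.neg_apply, hsub, hpow]
    field_simp
    ring
  have hFTC := intervalIntegral.integral_eq_sub_of_hasDerivAt_of_le zero_le_one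
    (hEc.mul (continuous_id.mul hPc).continuousOn) hderiv
    ((hI₁.const_mul θ).sub (hI₂.const_mul (θ - 1)))
  rw [intervalIntegral.integral_sub (hI₁.const_mul θ) (hI₂.const_mul (θ - 1)),
    intervalIntegral.integral_const_mul, intervalIntegral.integral_const_mul] at hFTC
  have h0 : (0 : ℝ) ^ (θ - 1) = 0 := Real.zero_rpow (by linarith)
  simp only [Pi.mul_apply, id, sub_self, h0, mul_zero, zero_mul] at hFTC
  exact sub_eq_zero.mp hFTC

end LogTransform

theorem stmt7 {Y : Type*} [MeasurableSpace Y] (H : Measure Y) [IsProbabilityMeasure H]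
    (g : Y → ℝ) (hg : Measurable g) (hg0 : ∀ y, 0 ≤ g y)
    (z θ : ℝ) (hz : 0 ≤ z) (hθ : 1 < θ)
    (hint : Integrable (fun y => Real.log (1 + z * g y)) H)
    (L : ℝ → ℝ) (hL : ∀ u, L u = ∫ y, Real.log (1 + u * z * g y) ∂H) :
    θ * ∫ u in Ioo (0:ℝ) 1,
        Real.exp (-(θ * L u)) * (∫ y, (1 + u * z * g y)⁻¹ ∂H) * (1 - u) ^ (θ - 1) =
      (θ - 1) * ∫ u in Ioo (0:ℝ) 1, Real.exp (-(θ * L u)) * (1 - u) ^ (θ - 2) := by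
  simp only [mul_assoc _ z] at hL ⊢
  simp only [← integral_Ioc_eq_integral_Ioo, ← intervalIntegral.integral_of_le zero_le_one]
  exact integral_exp_neg_mul_integral_inv_mul_rpow (hg.const_mul z)
    (fun y => mul_nonneg hz (hg0 y)) hint hθ hL
end

section
/- Let a, b > 0, set θ = a + b, let 0 < q < θ, and let x, y ≥ 0. Then (1/B(a,b)) ∫₀¹ u^{a−1} (1−u)^{b−1} (1 + x u + y (1−u))^{−q} du = (1/B(q, θ−q)) ∫₀¹ v^{q−1} (1−v)^{θ−q−1} (1 + v x)^{−a} (1 + v y)^{−b} dv. -/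
open MeasureTheory Set

theorem integral_Ioo_rpow_mul_one_sub_rpow {a b : ℝ} (ha : 0 < a) (hb : 0 < b) :
    ∫ u in Ioo (0:ℝ) 1, u ^ (a - 1) * (1 - u) ^ (b - 1) = ProbabilityTheory.beta a b := by
  have hβ := ProbabilityTheory.beta_pos ha hb
  have h := ProbabilityTheory.lintegral_betaPDF_eq_one ha hb
  rw [ProbabilityTheory.lintegral_betaPDF] at h
  have h1 : ∫ u in Ioo (0:ℝ) 1,
      1 / ProbabilityTheory.beta a b * u ^ (a - 1) * (1 - u) ^ (b - 1) = 1 := by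
    rw [integral_eq_lintegral_of_nonneg_ae, h, ENNReal.toReal_one]
    · filter_upwards [ae_restrict_mem measurableSet_Ioo] with u hu
      have := hu.1
      have : 0 < 1 - u := sub_pos.2 hu.2
      simp only [Pi.zero_apply]
      positivity
    · exact Measurable.aestronglyMeasurable (by fun_prop)
  simp_rw [mul_assoc] at h1
  rw [integral_const_mul] at h1
  field_simp at h1
  exact h1

theorem integrableOn_rpow_mul_one_sub_rpow {a b : ℝ} (ha : 0 < a) (hb : 0 < b) :
    IntegrableOn (fun u : ℝ ↦ u ^ (a - 1) * (1 - u) ^ (b - 1)) (Ioo 0 1) := by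
  apply Integrable.of_integral_ne_zero
  rw [integral_Ioo_rpow_mul_one_sub_rpow ha hb]
  exact (ProbabilityTheory.beta_pos ha hb).ne'

/-- The Feynman parametrization of `A ^ (-a) * B ^ (-b)`. -/
theorem integral_Ioo_feynman {a b A B : ℝ} (ha : 0 < a) (hb : 0 < b) (hA : 0 < A) (hB : 0 < B) :
    ∫ u in Ioo (0:ℝ) 1,
        u ^ (a - 1) * (1 - u) ^ (b - 1) * (A * u + B * (1 - u)) ^ (-(a + b)) =
      ProbabilityTheory.beta a b * (A ^ (-a) * B ^ (-b)) := by
  have hpos : ∀ {C D u : ℝ}, 0 < C → 0 < D → u ∈ Ioo (0:ℝ) 1 → 0 < C * u + D * (1 - u) := by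
    intro C D u hC hD hu
    have := mul_pos hC hu.1
    have := mul_pos hD (sub_pos.2 hu.2)
    linarith
  set f : ℝ → ℝ := fun u ↦ A * u / (A * u + B * (1 - u)) with hf
  have hf_one_sub : ∀ u ∈ Ioo (0:ℝ) 1, 1 - f u = B * (1 - u) / (A * u + B * (1 - u)) := by
    intro u hu
    have := (hpos hA hB hu).ne'
    simp only [hf]
    field_simp
    ring
  have hderiv : ∀ u ∈ Ioo (0:ℝ) 1,
      HasDerivWithinAt f (A * B / (A * u + B * (1 - u)) ^ 2) (Ioo 0 1) u := by
    intro u hu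
    have h1 : HasDerivAt (fun u : ℝ ↦ A * u) A u := by
      simpa using (hasDerivAt_id u).const_mul A
    have h2 : HasDerivAt (fun u : ℝ ↦ B * (1 - u)) (-B) u := by
      simpa using ((hasDerivAt_id u).const_sub 1).const_mul B
    refine ((h1.div (h1.add h2) (hpos hA hB hu).ne').congr_deriv ?_).hasDerivWithinAt
    simp only [Pi.add_apply]
    ring
  have hinj : InjOn f (Ioo 0 1) := by
    intro u hu w hw h
    have h1 := (hpos hA hB hu).ne'
    have h2 := (hpos hA hB hw).ne'
    simp only [hf] at h
    rw [div_eq_div_iff h1 h2] at h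
    have h3 : A * B * (u - w) = 0 := by linear_combination h
    have := (mul_eq_zero.1 h3).resolve_left (mul_pos hA hB).ne'
    linarith
  have himage : f '' Ioo 0 1 = Ioo 0 1 := by
    ext t
    constructor
    · rintro ⟨u, hu, rfl⟩
      have h1 := div_pos (mul_pos hA hu.1) (hpos hA hB hu)
      have h2 := div_pos (mul_pos hB (sub_pos.2 hu.2)) (hpos hA hB hu)
      rw [← hf_one_sub u hu] at h2
      exact ⟨h1, sub_pos.1 h2⟩
    · intro ht
      have hD := hpos hB hA ht
      have h1 : 0 < 1 - t := sub_pos.2 ht.2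
      have ht0 := ht.1
      refine ⟨B * t / (B * t + A * (1 - t)), ⟨by positivity, ?_⟩, ?_⟩
      · rw [div_lt_one hD]
        linarith [mul_pos hA h1]
      · have h2 : 1 - B * t / (B * t + A * (1 - t)) = A * (1 - t) / (B * t + A * (1 - t)) := by
          field_simp
          ring
        simp only [hf, h2]
        field_simp
        ring
  have hsubst := integral_image_eq_integral_abs_deriv_smul measurableSet_Ioo hderiv hinj
    (fun t ↦ t ^ (a - 1) * (1 - t) ^ (b - 1))
  rw [himage, integral_Ioo_rpow_mul_one_sub_rpow ha hb] at hsubst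
  rw [hsubst, ← integral_mul_const]
  refine setIntegral_congr_fun measurableSet_Ioo fun u hu ↦ ?_
  have hD := hpos hA hB hu
  have hu0 := hu.1
  have hu1 : 0 < 1 - u := sub_pos.2 hu.2
  simp only [smul_eq_mul, hf_one_sub u hu]
  simp only [hf]
  set D := A * u + B * (1 - u)
  rw [abs_of_pos (by positivity), Real.div_rpow (by positivity) hD.le,
    Real.div_rpow (by positivity) hD.le, Real.mul_rpow hA.le hu0.le, Real.mul_rpow hB.le hu1.le,
    Real.rpow_neg hA.le, Real.rpow_neg hB.le, Real.rpow_neg hD.le, Real.rpow_add hD,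
    Real.rpow_sub_one hA.ne', Real.rpow_sub_one hB.ne', Real.rpow_sub_one hD.ne',
    Real.rpow_sub_one hD.ne']
  field_simp

theorem stmt12 (a b q x y : ℝ) (ha : 0 < a) (hb : 0 < b) (hq : 0 < q) (hqθ : q < a + b)
    (hx : 0 ≤ x) (hy : 0 ≤ y) :
    (1 / (Real.Gamma a * Real.Gamma b / Real.Gamma (a + b))) *
        ∫ u in Ioo (0:ℝ) 1,
          u ^ (a - 1) * (1 - u) ^ (b - 1) * (1 + x * u + y * (1 - u)) ^ (-q) =
      (1 / (Real.Gamma q * Real.Gamma (a + b - q) / Real.Gamma (a + b))) *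
        ∫ v in Ioo (0:ℝ) 1,
          v ^ (q - 1) * (1 - v) ^ (a + b - q - 1) * ((1 + v * x) ^ (-a) * (1 + v * y) ^ (-b)) := by
  have hr : 0 < a + b - q := sub_pos.2 hqθ
  have hβ := ProbabilityTheory.beta_pos ha hb
  have hβ' := ProbabilityTheory.beta_pos hq hr
  let F : ℝ → ℝ → ℝ := fun u v ↦ (1 + v * (x * u + y * (1 - u))) ^ (-(a + b)) *
    ((u ^ (a - 1) * (1 - u) ^ (b - 1)) * (v ^ (q - 1) * (1 - v) ^ (a + b - q - 1)))
  have hint : Integrable (Function.uncurry F)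
      ((volume.restrict (Ioo (0:ℝ) 1)).prod (volume.restrict (Ioo (0:ℝ) 1))) := by
    refine ((integrableOn_rpow_mul_one_sub_rpow ha hb).mul_prod
      (integrableOn_rpow_mul_one_sub_rpow hq hr)).bdd_mul (c := 1)
      (Measurable.aestronglyMeasurable (by fun_prop)) ?_
    rw [Measure.prod_restrict]
    filter_upwards [ae_restrict_mem (measurableSet_Ioo.prod measurableSet_Ioo)] with p hp
    have hu0 := hp.1.1
    have hu1 : 0 < 1 - p.1 := sub_pos.2 hp.1.2
    have hv0 := hp.2.1
    have hm : 0 ≤ p.2 * (x * p.1 + y * (1 - p.1)) := by positivity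
    rw [Real.norm_of_nonneg (by positivity)]
    exact Real.rpow_le_one_of_one_le_of_nonpos (by linarith) (by linarith)
  have hswap := integral_integral_swap hint
  have hleft : ∫ u in Ioo (0:ℝ) 1, ∫ v in Ioo (0:ℝ) 1, F u v =
      ProbabilityTheory.beta q (a + b - q) * ∫ u in Ioo (0:ℝ) 1,
        u ^ (a - 1) * (1 - u) ^ (b - 1) * (1 + x * u + y * (1 - u)) ^ (-q) := by
    rw [← integral_const_mul]
    refine setIntegral_congr_fun measurableSet_Ioo fun u hu ↦ ?_
    have hu0 := hu.1
    have hu1 : 0 < 1 - u := sub_pos.2 hu.2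
    have h := integral_Ioo_feynman hq hr
      (show 0 < 1 + x * u + y * (1 - u) by positivity) one_pos
    rw [Real.one_rpow, mul_one] at h
    rw [mul_left_comm, ← h, ← integral_const_mul]
    congr 1 with v
    simp only [F]
    rw [show 1 + v * (x * u + y * (1 - u)) =
      (1 + x * u + y * (1 - u)) * v + 1 * (1 - v) by ring, add_sub_cancel q (a + b)]
    ring
  have hright : ∫ v in Ioo (0:ℝ) 1, ∫ u in Ioo (0:ℝ) 1, F u v =
      ProbabilityTheory.beta a b * ∫ v in Ioo (0:ℝ) 1,
        v ^ (q - 1) * (1 - v) ^ (a + b - q - 1) *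
          ((1 + v * x) ^ (-a) * (1 + v * y) ^ (-b)) := by
    rw [← integral_const_mul]
    refine setIntegral_congr_fun measurableSet_Ioo fun v hv ↦ ?_
    have hv0 := hv.1
    have h := integral_Ioo_feynman ha hb
      (show 0 < 1 + v * x by positivity) (show 0 < 1 + v * y by positivity)
    rw [mul_left_comm, ← h, ← integral_const_mul]
    congr 1 with u
    simp only [F]
    rw [show 1 + v * (x * u + y * (1 - u)) = (1 + v * x) * u + (1 + v * y) * (1 - u) by ring]
    ring
  rw [hleft, hright] at hswap
  have hβ'_eq : Real.Gamma q * Real.Gamma (a + b - q) / Real.Gamma (a + b) =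
      ProbabilityTheory.beta q (a + b - q) := by
    rw [ProbabilityTheory.beta, add_sub_cancel]
  rw [hβ'_eq, ← ProbabilityTheory.beta, one_div_mul_eq_div, one_div_mul_eq_div,
    div_eq_div_iff hβ.ne' hβ'.ne']
  linarith
end
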